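/- Let $D$ be a finite-dimensional associative central $K$-division algebra (i.e. $Z(D)=K\cdot 1_D$). Then a subfield of $D$ is a maximal element among the separable subfields of $D$ if and only if it is a maximal subfield of $D$ that is separable over $K$. -/

import Mathlib

open scoped TensorProduct

universe u

/-- An element `a` of an associative unital `K`-algebra `A` is *separable over `K`* if it is
algebraic over `K` and its minimal polynomial over `K` is separable, i.e. a product of pairwise
distinct irreducible separable polynomials of `K[t]`. -/
def IsSeparableElement (K : Type u) {A : Type u} [Field K] [Ring A] [Algebra K A] (a : A) : Prop :=
  IsIntegral K a ∧ (minpoly K a).Separable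

/-- A *subfield* of a `K`-division algebra `D` is a commutative unital `K`-subalgebra of `D`
which is a field, i.e. is moreover closed under inverses. -/
def IsSubfieldOf (K : Type u) {D : Type u} [Field K] [DivisionRing D] [Algebra K D]
    (S : Subalgebra K D) : Prop :=
  (∀ a ∈ S, ∀ b ∈ S, a * b = b * a) ∧ ∀ a ∈ S, a⁻¹ ∈ S

/-- A *maximal subfield* of `D` is a subfield not properly contained in any other subfield. -/
def IsMaximalSubfieldOf (K : Type u) {D : Type u} [Field K] [DivisionRing D] [Algebra K D]
    (S : Subalgebra K D) : Prop :=
  IsSubfieldOf K S ∧ ∀ T : Subalgebra K D, IsSubfieldOf K T → S ≤ T → S = T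

/-- A *separable subfield* of `D`: a subfield which is a separable field extension of `K`,
i.e. all of its elements are separable over `K`. -/
def IsSeparableSubfieldOf (K : Type u) {D : Type u} [Field K] [DivisionRing D] [Algebra K D]
    (S : Subalgebra K D) : Prop :=
  IsSubfieldOf K S ∧ ∀ a ∈ S, IsSeparableElement K a

section Helpers

variable {K D : Type u} [Field K] [DivisionRing D] [Algebra K D]

/-- In a central division algebra, if `∑ bᵢ x vᵢ = 0` for all `x` and the `vᵢ` are linearly
independent, then all `bᵢ` vanish. -/
theorem eq_zero_of_forall_sum_mul_mul_eq_zero (hcentral : Subalgebra.center K D = ⊥) (n : ℕ)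
    (v b : Fin n → D) (hv : LinearIndependent K v)
    (h : ∀ x : D, ∑ i, b i * x * v i = 0) : b = 0 := by
  induction n with
  | zero => exact Subsingleton.elim _ _
  | succ n ih =>
    have hv' : LinearIndependent K (fun i : Fin n => v i.castSucc) :=
      hv.comp _ (Fin.castSucc_injective n)
    by_cases hb : b (Fin.last n) = 0
    · have hinit := ih (fun i => v i.castSucc) (fun i => b i.castSucc) hv' fun x => by
        simpa [Fin.sum_univ_castSucc, hb] using h x
      funext i
      refine Fin.lastCases hb (fun i => ?_) i
      exact congrFun hinit i
    · exfalso
      set c : Fin (n + 1) → D := fun i => (b (Fin.last n))⁻¹ * b i with hc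
      have hlast : c (Fin.last n) = 1 := inv_mul_cancel₀ hb
      have hcrel : ∀ x : D, ∑ i, c i * x * v i = 0 := fun x => by
        have := congrArg ((b (Fin.last n))⁻¹ * ·) (h x)
        simpa [hc, Finset.mul_sum, mul_assoc] using this
      have hcomm : ∀ (y : D) (i : Fin n), c i.castSucc * y = y * c i.castSucc := fun y i => by
        have hzero := ih (fun i => v i.castSucc)
          (fun i => c i.castSucc * y - y * c i.castSucc) hv' fun x => by
            have h₁ := hcrel (y * x)
            have h₂ := congrArg (y * ·) (hcrel x)
            simp only [Fin.sum_univ_castSucc, hlast, mul_add, mul_zero, Finset.mul_sum,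
              one_mul] at h₁ h₂
            simp only [sub_mul, Finset.sum_sub_distrib, mul_assoc] at h₁ h₂ ⊢
            rw [sub_eq_zero]
            exact add_right_cancel (h₁.trans h₂.symm)
        exact sub_eq_zero.mp (congrFun hzero i)
      have hmem : ∀ i, ∃ k : K, algebraMap K D k = c i := fun i => by
        refine Fin.lastCases ⟨1, by simp [hlast]⟩ (fun i => ?_) i
        have : c i.castSucc ∈ Subalgebra.center K D :=
          Subalgebra.mem_center_iff.mpr fun y => (hcomm y i).symm
        rw [hcentral] at this
        exact Algebra.mem_bot.mp this
      choose k hk using hmem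
      have hk0 := Fintype.linearIndependent_iff.mp hv k
        (by simpa [Algebra.smul_def, hk] using hcrel 1) (Fin.last n)
      have := hk (Fin.last n)
      rw [hk0, hlast, map_zero] at this
      exact zero_ne_one this

/-- In a finite-dimensional central division algebra, a relation `∑ bᵢ x cᵢ = 0` valid for all `x`
may be contracted with any linear functional in the second factor. -/
theorem sum_smul_eq_zero_of_forall_sum_mul_mul_eq_zero [FiniteDimensional K D]
    (hcentral : Subalgebra.center K D = ⊥) {ι : Type*} (s : Finset ι) (b c : ι → D)
    (h : ∀ x : D, ∑ i ∈ s, b i * x * c i = 0) (l : D →ₗ[K] K) :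
    ∑ i ∈ s, l (c i) • b i = 0 := by
  let e := Module.finBasis K D
  have hcoeff := eq_zero_of_forall_sum_mul_mul_eq_zero hcentral _ e
    (fun j => ∑ i ∈ s, e.repr (c i) j • b i) e.linearIndependent fun x => by
      rw [← h x]
      simp only [Finset.sum_mul]
      rw [Finset.sum_comm]
      refine Finset.sum_congr rfl fun i _ => ?_
      conv_rhs => rw [← e.sum_repr (c i), Finset.mul_sum]
      simp
  have hl : ∀ y : D, l y = ∑ j, e.repr y j * l (e j) := fun y => by
    conv_lhs => rw [← e.sum_repr y, map_sum]
    simp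
  calc ∑ i ∈ s, l (c i) • b i
      = ∑ j, l (e j) • ∑ i ∈ s, e.repr (c i) j • b i := by
        simp only [Finset.smul_sum]
        rw [Finset.sum_comm]
        refine Finset.sum_congr rfl fun i _ => ?_
        rw [hl, Finset.sum_smul]
        refine Finset.sum_congr rfl fun j _ => ?_
        rw [smul_smul, mul_comm]
    _ = 0 := Finset.sum_eq_zero fun j _ => by
        have := congrFun hcoeff j
        simp only [Pi.zero_apply] at this
        rw [this, smul_zero]

open Polynomial in
/-- For `p(a) = 0`, the two-sided divided difference of `p` at `a` takes values in the centralizer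
of `a`. -/
theorem commute_sum_coeff_smul_geom_sum {a : D} {p : K[X]} (hp : aeval a p = 0) (x : D) :
    Commute a (∑ k ∈ Finset.range (p.natDegree + 1),
      p.coeff k • ∑ i ∈ Finset.range k, a ^ i * x * a ^ (k - 1 - i)) := by
  have hgeom : ∀ k, a * (∑ i ∈ Finset.range k, a ^ i * x * a ^ (k - 1 - i)) -
      (∑ i ∈ Finset.range k, a ^ i * x * a ^ (k - 1 - i)) * a = a ^ k * x - x * a ^ k := by
    intro k
    have := (LinearMap.commute_mulLeft_right (R := K) a a).mul_geom_sum₂ k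
    have := LinearMap.congr_fun this x
    rw [Finset.mul_sum, Finset.sum_mul]
    simpa [sub_mul, Finset.mul_sum, Finset.sum_sub_distrib, LinearMap.sum_apply, Module.End.mul_apply, LinearMap.pow_mulLeft,
      LinearMap.pow_mulRight, mul_assoc] using this
  have heval := hp
  rw [aeval_eq_sum_range] at heval
  rw [commute_iff_eq, ← sub_eq_zero, Finset.mul_sum, Finset.sum_mul, ← Finset.sum_sub_distrib]
  simp only [mul_smul_comm, smul_mul_assoc, ← smul_sub, hgeom]
  have hleft := congrArg (· * x) heval
  have hright := congrArg (x * ·) heval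
  simp only [Finset.sum_mul, Finset.mul_sum, smul_mul_assoc, mul_smul_comm, zero_mul,
    mul_zero] at hleft hright
  simp only [smul_sub, Finset.sum_sub_distrib, hleft, hright, sub_zero]

/-- The double centralizer theorem for a subalgebra generated by one element. -/
theorem mem_adjoin_singleton_of_mem_centralizer_centralizer [FiniteDimensional K D]
    (hcentral : Subalgebra.center K D = ⊥) (a z : D)
    (hz : ∀ c : D, Commute a c → Commute z c) : z ∈ Algebra.adjoin K {a} := by
  have hint : IsIntegral K a := Algebra.IsIntegral.isIntegral a
  set p := minpoly K a with hp
  have hdeg : 0 < p.natDegree := minpoly.natDegree_pos hint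
  obtain ⟨l, hl⟩ : ∃ l : D →ₗ[K] K, ∀ j < p.natDegree,
      l (a ^ j) = if j = p.natDegree - 1 then 1 else 0 := by
    obtain ⟨f, hf⟩ := LinearMap.exists_leftInverse_of_injective _
      (LinearMap.ker_eq_bot.mpr (linearIndependent_pow (K := K) a))
    refine ⟨Finsupp.lapply ⟨p.natDegree - 1, Nat.sub_lt hdeg one_pos⟩ ∘ₗ f, fun j hj => ?_⟩
    have := LinearMap.congr_fun hf (Finsupp.single ⟨j, hj⟩ 1)
    simp only [LinearMap.comp_apply, Finsupp.linearCombination_single, one_smul,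
      LinearMap.id_apply] at this
    simp [this, Finsupp.single_apply]
  let s := (Finset.range (p.natDegree + 1)).sigma fun k => Finset.range k
  have hrel : ∀ x : D, ∑ q ∈ s.disjSum s,
      Sum.elim (fun q : (_ : ℕ) × ℕ => p.coeff q.1 • (z * a ^ q.2))
        (fun q => -(p.coeff q.1 • a ^ q.2)) q * x *
      Sum.elim (fun q : (_ : ℕ) × ℕ => a ^ (q.1 - 1 - q.2))
        (fun q => a ^ (q.1 - 1 - q.2) * z) q = 0 := fun x => by
    have := hz _ (commute_sum_coeff_smul_geom_sum (minpoly.aeval K a) x)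
    rw [commute_iff_eq, ← sub_eq_zero] at this
    rw [Finset.sum_disjSum]
    simp only [Sum.elim_inl, Sum.elim_inr, s, Finset.sum_sigma]
    rw [← this]
    simp only [Finset.mul_sum, Finset.sum_mul, Finset.smul_sum, smul_mul_assoc, mul_smul_comm,
      mul_assoc, neg_mul, Finset.sum_neg_distrib, sub_eq_add_neg, hp]
  have hcontr := sum_smul_eq_zero_of_forall_sum_mul_mul_eq_zero hcentral _ _ _ hrel l
  rw [Finset.sum_disjSum] at hcontr
  simp only [Sum.elim_inl, Sum.elim_inr, smul_neg, Finset.sum_neg_distrib] at hcontr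
  have hlead : ∑ q ∈ s, l (a ^ (q.1 - 1 - q.2)) • (p.coeff q.1 • (z * a ^ q.2)) = z := by
    rw [Finset.sum_eq_single ⟨p.natDegree, 0⟩]
    · have hcoeff : p.coeff p.natDegree = 1 := (minpoly.monic hint).coeff_natDegree
      simp [hl (p.natDegree - 1) (by omega), hcoeff]
    · rintro ⟨k, i⟩ hq hne
      simp only [s, Finset.mem_sigma, Finset.mem_range] at hq
      dsimp only
      rw [hl _ (by omega), if_neg, zero_smul]
      intro heq
      apply hne
      obtain rfl : k = p.natDegree := by omega
      obtain rfl : i = 0 := by omega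
      rfl
    · intro hq
      exact absurd (by simp [s, hdeg]) hq
  rw [hlead, ← sub_eq_add_neg, sub_eq_zero] at hcontr
  rw [hcontr]
  exact Subalgebra.sum_mem _ fun q _ => Subalgebra.smul_mem _ (Subalgebra.smul_mem _
    (Subalgebra.pow_mem _ (Algebra.self_mem_adjoin_singleton K a) _) _) _

/-- Subalgebras of finite-dimensional division algebras are closed under inverses. -/
theorem Subalgebra.inv_mem_of_finiteDimensional [FiniteDimensional K D] (S : Subalgebra K D)
    {a : D} (ha : a ∈ S) : a⁻¹ ∈ S := by
  by_cases h0 : a = 0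
  · simp [h0]
  have hinj : Function.Injective (LinearMap.mulLeft K (⟨a, ha⟩ : S)) := fun x y hxy =>
    Subtype.ext (mul_left_cancel₀ h0 (congrArg Subtype.val hxy))
  obtain ⟨y, hy⟩ := LinearMap.injective_iff_surjective.mp hinj 1
  have hay : a * (y : D) = 1 := congrArg Subtype.val hy
  rw [← eq_inv_of_mul_eq_one_right hay]
  exact y.2

/-- A subalgebra of a finite-dimensional division algebra is a division ring. -/
noncomputable abbrev Subalgebra.divisionRingOfFiniteDimensional [FiniteDimensional K D]
    (S : Subalgebra K D) : DivisionRing S :=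
  { S.toRing with
    inv := fun a => ⟨(a : D)⁻¹, S.inv_mem_of_finiteDimensional a.2⟩
    exists_pair_ne := exists_pair_ne S
    mul_inv_cancel := fun a ha =>
      Subtype.ext (mul_inv_cancel₀ fun h => ha (Subtype.ext h))
    inv_zero := Subtype.ext inv_zero
    nnqsmul := _
    nnqsmul_def := fun _ _ => rfl
    qsmul := _
    qsmul_def := fun _ _ => rfl }

/-- A subfield of a finite-dimensional division algebra is a field. -/
noncomputable abbrev IsSubfieldOf.toField [FiniteDimensional K D] {S : Subalgebra K D}
    (h : IsSubfieldOf K S) : Field S :=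
  { S.divisionRingOfFiniteDimensional with
    mul_comm := fun a b => Subtype.ext (h.1 a a.2 b b.2) }

theorem IsSeparableSubfieldOf.exists_eq_adjoin [FiniteDimensional K D] {S : Subalgebra K D}
    (h : IsSeparableSubfieldOf K S) : ∃ a : D, S = Algebra.adjoin K {a} := by
  let _ := h.1.toField
  have : Algebra.IsSeparable K S := ⟨fun x => by
    have := (h.2 x x.2).2
    rwa [← Subalgebra.coe_val, minpoly.algHom_eq S.val Subtype.val_injective] at this⟩
  obtain ⟨α, hα⟩ := Field.exists_primitive_element K S
  refine ⟨α, ?_⟩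
  have htop : Algebra.adjoin K {α} = ⊤ := by
    rw [← IntermediateField.adjoin_simple_toSubalgebra_of_isAlgebraic
      (Algebra.IsAlgebraic.isAlgebraic α), hα, IntermediateField.top_toSubalgebra]
  have := congrArg (Subalgebra.map S.val) htop
  rw [AlgHom.map_adjoin, Set.image_singleton, Algebra.map_top, Subalgebra.range_val] at this
  exact this.symm

theorem isSubfieldOf_adjoin_pair [FiniteDimensional K D] {a x : D} (hax : Commute a x) :
    IsSubfieldOf K (Algebra.adjoin K {a, x}) := by
  refine ⟨fun b hb c hc => ?_, fun b hb => Subalgebra.inv_mem_of_finiteDimensional _ hb⟩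
  refine Algebra.commute_of_mem_adjoin_of_forall_mem_commute hc fun y hy => ?_
  refine (Algebra.commute_of_mem_adjoin_of_forall_mem_commute hb fun w hw => ?_).symm
  rcases hy with rfl | rfl <;> rcases hw with rfl | rfl
  exacts [Commute.refl _, hax, hax.symm, Commute.refl _]

open Polynomial in
/-- If `a` is separable over `K` and `x` commutes with `a` and is a root of a separable polynomial
over a field of elements of a separable subfield generated by `a`, then `K[a, x]` is a separable
subfield. -/
theorem isSeparableSubfieldOf_adjoin_pair [FiniteDimensional K D] {a x : D} (hax : Commute a x)
    (hsep : ∀ b ∈ Algebra.adjoin K {a}, IsSeparableElement K b)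
    {Z : Type u} [Field Z] (f : Z →+* D) (hf : ∀ c, f c ∈ Algebra.adjoin K {a})
    {g : Z[X]} (hg : g.Separable) (hx : g.eval₂ f x = 0) :
    IsSeparableSubfieldOf K (Algebra.adjoin K {a, x}) := by
  have hT := isSubfieldOf_adjoin_pair (K := K) hax
  refine ⟨hT, ?_⟩
  set T := Algebra.adjoin K {a, x} with hTdef
  let _ := hT.toField
  have hminpoly : ∀ t : T, minpoly K (t : D) = minpoly K t := fun t =>
    minpoly.algHom_eq T.val Subtype.val_injective t
  have hle : Algebra.adjoin K {a} ≤ T := Algebra.adjoin_mono (by simp)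
  have haT : a ∈ T := Algebra.subset_adjoin (by simp)
  have hxT : x ∈ T := Algebra.subset_adjoin (by simp)
  have hmem : ∀ (b : D) (hb : b ∈ Algebra.adjoin K {a}),
      (⟨b, hle hb⟩ : T) ∈ separableClosure K T := fun b hb => by
    rw [mem_separableClosure_iff, IsSeparable, ← hminpoly]
    exact (hsep b hb).2
  let φ : Z →+* separableClosure K T :=
    { toFun := fun c => ⟨⟨f c, hle (hf c)⟩, hmem _ (hf c)⟩
      map_one' := Subtype.ext (Subtype.ext (map_one f))
      map_zero' := Subtype.ext (Subtype.ext (map_zero f))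
      map_add' := fun c d => Subtype.ext (Subtype.ext (map_add f c d))
      map_mul' := fun c d => Subtype.ext (Subtype.ext (map_mul f c d)) }
  have hroot : aeval (⟨x, hxT⟩ : T) (g.map φ) = 0 := by
    apply Subtype.val_injective
    rw [aeval_def, eval₂_map]
    have := hom_eval₂ g ((algebraMap (separableClosure K T) T).comp φ) T.val.toRingHom ⟨x, hxT⟩
    exact this.trans hx
  have hxsep : IsSeparable (separableClosure K T) (⟨x, hxT⟩ : T) :=
    (hg.map (f := φ)).of_dvd (minpoly.dvd _ _ hroot)
  have hxK : (⟨x, hxT⟩ : T) ∈ separableClosure K T :=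
    mem_separableClosure_iff.mpr (IsSeparable.of_algebra_isSeparable_of_isSeparable K hxsep)
  have hTle : T ≤ (separableClosure K T).toSubalgebra.map T.val := by
    refine Algebra.adjoin_le ?_
    rintro y (rfl | rfl)
    · exact ⟨_, hmem y (Algebra.self_mem_adjoin_singleton K y), rfl⟩
    · exact ⟨_, hxK, rfl⟩
  intro b hb
  obtain ⟨t, ht, rfl⟩ := hTle hb
  refine ⟨Algebra.IsIntegral.isIntegral _, ?_⟩
  have := mem_separableClosure_iff.mp ht
  rw [IsSeparable, ← hminpoly] at this
  exact this

/-- The centralizer of an element `a` with `K[a]` separable over `K` is either `K[a]` or contains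
an element `x` outside `K[a]` such that `K[a, x]` is separable over `K`. -/
theorem exists_isSeparableSubfieldOf_adjoin_pair [FiniteDimensional K D]
    (hcentral : Subalgebra.center K D = ⊥) {a : D}
    (hsep : ∀ b ∈ Algebra.adjoin K {a}, IsSeparableElement K b)
    (hne : ¬ Subalgebra.centralizer K {a} ≤ Algebra.adjoin K {a}) :
    ∃ x ∉ Algebra.adjoin K {a}, IsSeparableSubfieldOf K (Algebra.adjoin K {a, x}) := by
  set C := Subalgebra.centralizer K {a} with hC
  have hmemC : ∀ {c : D}, c ∈ C ↔ Commute a c := fun {c} => by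
    simp [hC, Subalgebra.mem_centralizer_iff, commute_iff_eq]
  let _ := C.divisionRingOfFiniteDimensional
  have hcenter : ∀ c : C, c ∈ Subring.center C → (c : D) ∈ Algebra.adjoin K {a} := fun c hc =>
    mem_adjoin_singleton_of_mem_centralizer_centralizer hcentral a c fun d hd =>
      (congrArg Subtype.val (Subring.mem_center_iff.mp hc ⟨d, hmemC.mpr hd⟩)).symm
  let _ : Algebra K (Subring.center C) :=
    ((algebraMap K C).codRestrict (Subring.center C) fun k =>
      Subring.mem_center_iff.mpr fun c => (Algebra.commutes k c).symm).toAlgebra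
  have : IsScalarTower K (Subring.center C) C := .of_algebraMap_eq fun _ => rfl
  have : Algebra.IsAlgebraic (Subring.center C) C := .tower_top (K := K) _
  have htop : Subring.center C ≠ ⊤ := fun h =>
    hne fun c hc => hcenter ⟨c, hc⟩ (h ▸ Subring.mem_top _)
  obtain ⟨x, hx, hxsep⟩ := JacobsonNoether.exists_separable_and_not_isCentral C htop
  refine ⟨x, fun hmem => hx (Subring.mem_center_iff.mpr fun c => Subtype.ext ?_), ?_⟩
  · refine Algebra.commute_of_mem_adjoin_of_forall_mem_commute hmem fun y hy => ?_
    rw [Set.mem_singleton_iff.mp hy]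
    exact (hmemC.mp c.2).symm
  · refine isSeparableSubfieldOf_adjoin_pair (hmemC.mp x.2) hsep
      (C.val.toRingHom.comp (Subring.center C).subtype) (fun c => hcenter c c.2) hxsep ?_
    have := congrArg C.val (minpoly.aeval (Subring.center C) x)
    rw [map_zero, Polynomial.aeval_def] at this
    rw [← this]
    exact (Polynomial.hom_eval₂ _ _ C.val.toRingHom x).symm

end Helpers

/-- Let `D` be a finite-dimensional associative central `K`-division algebra (`Z(D) = K·1`).
A subfield `S` of `D` is a maximal element among the separable subfields of `D` if and only if
`S` is a maximal subfield of `D` which is separable over `K`. -/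
theorem maximal_separable_subfield_iff_separable_maximal_subfield
    (K D : Type u) [Field K] [DivisionRing D] [Algebra K D] [FiniteDimensional K D]
    (hcentral : Subalgebra.center K D = ⊥)
    (S : Subalgebra K D) (hS : IsSubfieldOf K S) :
    (IsSeparableSubfieldOf K S ∧
        ∀ T : Subalgebra K D, IsSeparableSubfieldOf K T → S ≤ T → S = T) ↔
      (IsMaximalSubfieldOf K S ∧ ∀ a ∈ S, IsSeparableElement K a) := by
  constructor
  · rintro ⟨hsep, hmax⟩
    refine ⟨⟨hS, fun T hT hST => le_antisymm hST fun t ht => ?_⟩, hsep.2⟩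
    obtain ⟨a, rfl⟩ := hsep.exists_eq_adjoin
    have ha := Algebra.self_mem_adjoin_singleton K a
    by_cases hle : Subalgebra.centralizer K {a} ≤ Algebra.adjoin K {a}
    · refine hle (Subalgebra.mem_centralizer_iff K |>.mpr fun y hy => ?_)
      rw [Set.mem_singleton_iff.mp hy]
      exact hT.1 a (hST ha) t ht
    · obtain ⟨x, hx, hxsep⟩ := exists_isSeparableSubfieldOf_adjoin_pair hcentral hsep.2 hle
      have heq := hmax _ hxsep (Algebra.adjoin_mono (by simp))
      exact absurd (heq ▸ Algebra.subset_adjoin (by simp)) hx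
  · rintro ⟨⟨_, hmax⟩, hsep⟩
    exact ⟨⟨hS, hsep⟩, fun T hT hST => hmax T hT.1 hST⟩
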